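/- arXiv:1702.06468 — 2 statements merged into one kernel-verified Lean document; each statement's English description precedes it below -/
import Mathlib

section
/- For every v ∈ C²(cl(B₁); ℝ) and every r ∈ [0,1], ∫_{∂B_r} |D²v| dH¹ ≥ ( 4π | ∫_{B_r} det D²v dL² | )^{1/2}. -/
open MeasureTheory Metric Real Filter Matrix
open scoped ENNReal Topology

noncomputable section

/-- The plane `ℝ²` with the Euclidean norm. -/
abbrev E2 : Type := EuclideanSpace ℝ (Fin 2)
/-- The space `ℝ³` with the Euclidean norm. -/
abbrev E3 : Type := EuclideanSpace ℝ (Fin 3)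

/-- The `i`-th standard basis vector of `ℝ²`. -/
def e2 (i : Fin 2) : E2 := EuclideanSpace.single i 1

/-- Partial derivative in the direction of the `i`-th coordinate. -/
def pd (i : Fin 2) (f : E2 → ℝ) (x : E2) : ℝ := fderiv ℝ f x (e2 i)

/-- Hessian matrix of a scalar function on `ℝ²`. -/
def hess (f : E2 → ℝ) (x : E2) : Matrix (Fin 2) (Fin 2) ℝ :=
  Matrix.of fun i j => pd i (pd j f) x

/-- Derivative matrix `Dy ∈ ℝ^{3×2}` of a map `y : ℝ² → ℝ³`. -/
def Dmat (y : E2 → E3) (x : E2) : Matrix (Fin 3) (Fin 2) ℝ :=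
  Matrix.of fun i j => pd j (fun z => y z i) x

/-- Induced metric `g_y = (Dy)ᵀ Dy`. -/
def gmet (y : E2 → E3) (x : E2) : Matrix (Fin 2) (Fin 2) ℝ :=
  (Dmat y x)ᵀ * Dmat y x

/-- The rotated vector `x⊥ = (-x₂, x₁)`. -/
def perpVec (x : E2) : Fin 2 → ℝ := ![-(x 1), x 0]

/-- The unit tangent `x̂⊥ = (-x₂, x₁)/|x|`. -/
def xperpUnit (x : E2) : Fin 2 → ℝ := fun i => perpVec x i / ‖x‖

/-- The reference (cone) metric `g_Δ = Id - Δ² x̂⊥ ⊗ x̂⊥`. -/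
def gDelta (Δ : ℝ) (x : E2) : Matrix (Fin 2) (Fin 2) ℝ :=
  1 - Matrix.of fun i j => (Δ ^ 2 / ‖x‖ ^ 2) * perpVec x i * perpVec x j

/-- Squared Frobenius norm of a matrix. -/
def frob2 {m n : Type*} [Fintype m] [Fintype n] (A : Matrix m n ℝ) : ℝ :=
  ∑ i, ∑ j, (A i j) ^ 2

/-- `|D²y|²`: the sum of the squared Frobenius norms of the Hessians of the components. -/
def hessNormSq (y : E2 → E3) (x : E2) : ℝ :=
  ∑ i : Fin 3, frob2 (hess (fun z => y z i) x)

/-- The free elastic energy `I_{h,Δ}(y)`. -/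
def energy (h Δ : ℝ) (y : E2 → E3) : ℝ :=
  ∫ x in ball (0 : E2) 1, (frob2 (gmet y x - gDelta Δ x) + h ^ 2 * hessNormSq y x)

/-- The singular cone `y^Δ(x) = √(1-Δ²)·(x,0) + Δ|x| e₃`. -/
def coneMap (Δ : ℝ) (x : E2) : E3 :=
  (WithLp.equiv 2 (Fin 3 → ℝ)).symm
    ![Real.sqrt (1 - Δ ^ 2) * x 0, Real.sqrt (1 - Δ ^ 2) * x 1, Δ * ‖x‖]



def cphi (r θ : ℝ) : E2 := !₂[r * Real.cos θ, r * Real.sin θ]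

lemma cphi_dist_sq (r a b : ℝ) :
    dist (cphi r a) (cphi r b) ^ 2 = r ^ 2 * (2 - 2 * Real.cos (a - b)) := by
  rw [EuclideanSpace.dist_eq, Real.sq_sqrt (by positivity)]
  simp only [cphi, Fin.sum_univ_two, Real.dist_eq, sq_abs, Real.cos_sub]
  simp
  nlinarith [Real.sin_sq_add_cos_sq a, Real.sin_sq_add_cos_sq b]

lemma cphi_dist_le {r : ℝ} (hr : 0 ≤ r) (a b : ℝ) :
    dist (cphi r a) (cphi r b) ≤ r * |a - b| := by
  apply le_of_sq_le_sq _ (by positivity)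
  rw [cphi_dist_sq, mul_pow, sq_abs]
  have := Real.one_sub_sq_div_two_le_cos (x := a - b)
  apply mul_le_mul_of_nonneg_left _ (by positivity)
  linarith

lemma cphi_dist_ge (r a d : ℝ) :
    2 * r * Real.sin (d / 2) ≤ dist (cphi r a) (cphi r (a + d)) := by
  apply le_of_sq_le_sq _ (by positivity)
  rw [cphi_dist_sq]
  have h : a - (a + d) = -(2 * (d / 2)) := by ring
  rw [h, Real.cos_neg, Real.cos_two_mul]
  nlinarith [Real.sin_sq_add_cos_sq (d / 2)]

lemma cphi_lip {r : ℝ} (hr : 0 ≤ r) : LipschitzWith (Real.toNNReal r) (cphi r) := by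
  apply LipschitzWith.of_dist_le_mul
  intro a b
  rw [Real.coe_toNNReal r hr, Real.dist_eq]
  exact cphi_dist_le hr a b

lemma cphi_image_le {r : ℝ} (hr : 0 ≤ r) (s : Set ℝ) :
    μH[1] (cphi r '' s) ≤ ENNReal.ofReal r * volume s := by
  have := (cphi_lip hr).hausdorffMeasure_image_le (d := 1) zero_le_one s
  rw [hausdorffMeasure_real] at this
  simpa [ENNReal.ofReal] using this

lemma cphi_injOn {r : ℝ} (hr : 0 < r) : Set.InjOn (cphi r) (Set.Ioc (-π) π) := by
  intro a ha b hb h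
  have h0 : r * Real.cos a = r * Real.cos b := by simpa [cphi] using congrArg (fun x : E2 => x 0) h
  have h1 : r * Real.sin a = r * Real.sin b := by simpa [cphi] using congrArg (fun x : E2 => x 1) h
  have h0 := mul_left_cancel₀ hr.ne' h0
  have h1 := mul_left_cancel₀ hr.ne' h1
  rw [← Complex.arg_mul_cos_add_sin_mul_I hr ha, ← Complex.arg_mul_cos_add_sin_mul_I hr hb]
  rw [← Complex.ofReal_cos, ← Complex.ofReal_cos, ← Complex.ofReal_sin, ← Complex.ofReal_sin, h0, h1]

lemma cphi_mem_sphere {r : ℝ} (hr : 0 ≤ r) (θ : ℝ) : cphi r θ ∈ sphere (0 : E2) r := by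
  rw [mem_sphere_zero_iff_norm, EuclideanSpace.norm_eq, Real.sqrt_eq_iff_mul_self_eq (by positivity) hr]
  simp [cphi, Fin.sum_univ_two]
  nlinarith [Real.sin_sq_add_cos_sq θ]

lemma cphi_surj {r : ℝ} (x : E2) (hx : x ∈ sphere (0 : E2) r) :
    ∃ θ ∈ Set.Ioc (-π) π, cphi r θ = x := by
  rw [mem_sphere_zero_iff_norm] at hx
  let z : ℂ := ⟨x 0, x 1⟩
  have hz : ‖z‖ = r := by
    rw [← hx, Complex.norm_def, EuclideanSpace.norm_eq]
    simp [Complex.normSq_apply, Fin.sum_univ_two, z, sq]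
  refine ⟨z.arg, z.arg_mem_Ioc, ?_⟩
  have h1 := Complex.norm_mul_cos_arg z
  have h2 := Complex.norm_mul_sin_arg z
  rw [hz] at h1 h2
  ext i
  fin_cases i
  · simpa [cphi] using h1
  · simpa [cphi] using h2

lemma arc_ge {r : ℝ} (hr : 0 ≤ r) (a d : ℝ) (hd : 0 ≤ d) :
    ENNReal.ofReal (2 * r * Real.sin (d / 2)) ≤ μH[1] (cphi r '' Set.Ioc a (a + d)) := by
  have hlip : LipschitzWith 1 (fun x : E2 => dist (cphi r a) x) := LipschitzWith.dist_right _
  have h1 := hlip.hausdorffMeasure_image_le (d := 1) zero_le_one (cphi r '' Set.Ioc a (a + d))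
  rw [hausdorffMeasure_real, ← Set.image_comp] at h1
  have h2 := intermediate_value_Ioc (f := (fun x : E2 => dist (cphi r a) x) ∘ cphi r)
    (show a ≤ a + d by linarith) (hlip.continuous.comp (cphi_lip hr).continuous).continuousOn
  have h3 := (measure_mono (μ := volume) h2).trans h1
  simp only [Real.volume_Ioc, Function.comp, dist_self, sub_zero, ENNReal.coe_one, ENNReal.one_rpow,
    one_mul] at h3
  exact (ENNReal.ofReal_le_ofReal (cphi_dist_ge r a d)).trans h3

lemma sphere_ge {r : ℝ} (hr : 0 < r) :
    ENNReal.ofReal (2 * π * r) ≤ μH[1] (sphere (0 : E2) r) := by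
  have key : ∀ n : ℕ, ENNReal.ofReal (2 * r * (π - π ^ 3 / 6 * (1 / ((n : ℝ) + 1)) ^ 2)) ≤
      μH[1] (sphere (0 : E2) r) := by
    intro n
    set N : ℝ := (n : ℝ) + 1 with hN
    have hNpos : 0 < N := by positivity
    set d : ℝ := 2 * π / N with hd
    have hdpos : 0 < d := by positivity
    let I : ℕ → Set ℝ := fun k => Set.Ioc (-π + k * d) (-π + k * d + d)
    have hNd : N * d = 2 * π := by rw [hd]; field_simp
    have hI : ∀ k ∈ Finset.range (n + 1), I k ⊆ Set.Ioc (-π) π := by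
      intro k hk x hx
      have hk' : (k : ℝ) + 1 ≤ N := by
        rw [hN]; have := Finset.mem_range.1 hk; exact_mod_cast this
      have hk0 : (0 : ℝ) ≤ k := by positivity
      constructor
      · have := hx.1; nlinarith
      · have := hx.2; nlinarith
    have hdisj : ∀ j k : ℕ, j < k → Disjoint (I j) (I k) := by
      intro j k h
      rw [Set.disjoint_left]
      intro x hx hx'
      have h1 := hx.2
      have h2 := hx'.1
      have : (j : ℝ) + 1 ≤ k := by exact_mod_cast h
      nlinarith
    have hsum : ∑ k ∈ Finset.range (n + 1), μH[1] (cphi r '' I k) ≤ μH[1] (sphere (0 : E2) r) := by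
      rw [← measure_biUnion_finset]
      · apply measure_mono
        intro x hx
        simp only [Set.mem_iUnion] at hx
        obtain ⟨k, _, θ, _, rfl⟩ := hx
        exact cphi_mem_sphere hr.le θ
      · intro j hj k hk hjk
        have hd' : Disjoint (I j) (I k) := by
          rcases lt_or_gt_of_ne hjk with h | h
          · exact hdisj j k h
          · exact (hdisj k j h).symm
        refine Set.disjoint_left.2 ?_
        rintro _ ⟨u, hu, rfl⟩ ⟨w, hw, hwu⟩
        have := cphi_injOn hr (hI k hk hw) (hI j hj hu) hwu
        subst this
        exact Set.disjoint_left.1 hd' hu hw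
      · intro k hk
        exact measurableSet_Ioc.image_of_continuousOn_injOn (cphi_lip hr.le).continuous.continuousOn
          ((cphi_injOn hr).mono (hI k hk))
    refine le_trans ?_ hsum
    have h1 : ∑ k ∈ Finset.range (n + 1), ENNReal.ofReal (2 * r * Real.sin (d / 2)) ≤
      ∑ k ∈ Finset.range (n + 1), μH[1] (cphi r '' I k) :=
      Finset.sum_le_sum fun k _ => arc_ge hr.le _ d hdpos.le
    refine le_trans ?_ h1
    rw [Finset.sum_const, Finset.card_range, nsmul_eq_mul, ← ENNReal.ofReal_natCast,
      ← ENNReal.ofReal_mul (by positivity)]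
    apply ENNReal.ofReal_le_ofReal
    have h3 := Real.sin_gt_sub_cube (x := d / 2) (by positivity)
    have h4 : d / 2 = π / N := by rw [hd]; field_simp
    rw [h4] at h3 ⊢
    push_cast
    rw [← hN]
    calc 2 * r * (π - π ^ 3 / 6 * (1 / N) ^ 2) = N * (2 * r * (π / N - (π / N) ^ 3 / 6)) := by
          field_simp
      _ ≤ _ := by gcongr
  refine le_of_tendsto' (x := atTop) ?_ key
  apply ENNReal.tendsto_ofReal
  have h := (tendsto_one_div_add_atTop_nhds_zero_nat (𝕜 := ℝ))
  have h2 := ((h.pow 2).const_mul (π ^ 3 / 6)).const_sub π |>.const_mul (2 * r)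
  convert h2 using 2
  ring

lemma sphere_measure {r : ℝ} (hr : 0 < r) :
    (μH[1] : Measure E2).restrict (sphere 0 r) =
      ENNReal.ofReal r • (volume.restrict (Set.Ioc (-π) π)).map (cphi r) := by
  have hc : Continuous (cphi r) := (cphi_lip hr.le).continuous
  have hm := hc.measurable
  have hle : (μH[1] : Measure E2).restrict (sphere 0 r) ≤
      ENNReal.ofReal r • (volume.restrict (Set.Ioc (-π) π)).map (cphi r) := by
    rw [Measure.le_iff]
    intro s hs
    rw [Measure.restrict_apply hs, Measure.smul_apply, Measure.map_apply hm hs,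
      Measure.restrict_apply (hm hs), smul_eq_mul]
    refine le_trans (measure_mono ?_) (cphi_image_le hr.le _)
    rintro x ⟨hx, hx'⟩
    obtain ⟨θ, hθ, rfl⟩ := cphi_surj x hx'
    exact ⟨θ, ⟨hx, hθ⟩, rfl⟩
  have huniv : (ENNReal.ofReal r • (volume.restrict (Set.Ioc (-π) π)).map (cphi r)) Set.univ =
      ENNReal.ofReal (2 * π * r) := by
    rw [Measure.smul_apply, Measure.map_apply hm MeasurableSet.univ]
    simp only [Set.preimage_univ, Measure.restrict_apply_univ, Real.volume_Ioc, smul_eq_mul]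
    rw [← ENNReal.ofReal_mul hr.le]
    congr 1; ring
  have hge : ENNReal.ofReal (2 * π * r) ≤ ((μH[1] : Measure E2).restrict (sphere 0 r)) Set.univ := by
    rw [Measure.restrict_apply_univ]; exact sphere_ge hr
  have hle' := Measure.le_iff'.1 hle Set.univ
  rw [huniv] at hle'
  have : IsFiniteMeasure ((μH[1] : Measure E2).restrict (sphere 0 r)) :=
    ⟨lt_of_le_of_lt hle' ENNReal.ofReal_lt_top⟩
  exact Measure.eq_of_le_of_measure_univ_eq hle (by rw [huniv]; exact le_antisymm hle' hge)

lemma sphere_integral {r : ℝ} (hr : 0 < r) (f : E2 → ℝ) (hf : Continuous f) :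
    ∫ x in sphere (0 : E2) r, f x ∂μH[1] = ∫ θ in (-π)..π, r * f (cphi r θ) := by
  have hc : Continuous (cphi r) := (cphi_lip hr.le).continuous
  rw [sphere_measure hr, integral_smul_measure, integral_map hc.aemeasurable
    hf.aestronglyMeasurable, intervalIntegral.integral_of_le (by linarith [Real.pi_pos]),
    integral_const_mul, ENNReal.toReal_ofReal hr.le, smul_eq_mul]

lemma cot_endpoint (f s : ℝ → ℝ) (f' σ c : ℝ) (hf : HasDerivAt f f' c)
    (hs : HasDerivAt s σ c) (hσ : 0 < σ) (hfc : f c = 0) (hsc : Real.sin (s c) = 0) :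
    ContinuousAt (fun t => f t ^ 2 * (Real.cos (s t) / Real.sin (s t))) c := by
  have hcos : Real.cos (s c) ≠ 0 := by
    intro h
    have := Real.sin_sq_add_cos_sq (s c)
    rw [h, hsc] at this
    norm_num at this
  have hS : HasDerivAt (fun t => Real.sin (s t)) (Real.cos (s c) * σ) c := hs.sin
  have h1 := hasDerivAt_iff_tendsto_slope.1 hf
  have h2 := hasDerivAt_iff_tendsto_slope.1 hS
  have hne : Real.cos (s c) * σ ≠ 0 := mul_ne_zero hcos hσ.ne'
  have hf0 : Tendsto f (𝓝[≠] c) (𝓝 0) := by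
    have := hf.continuousAt.tendsto
    rw [hfc] at this
    exact this.mono_left nhdsWithin_le_nhds
  have hcs : Tendsto (fun t => Real.cos (s t)) (𝓝[≠] c) (𝓝 (Real.cos (s c))) :=
    (hs.cos.continuousAt.tendsto).mono_left nhdsWithin_le_nhds
  have h3 := (hf0.mul (h1.mul (h2.inv₀ hne))).mul hcs
  rw [continuousAt_iff_punctured_nhds]
  simp only [hfc, zero_mul, ne_eq, OfNat.ofNat_ne_zero, not_false_eq_true, zero_pow] at h3 ⊢
  refine h3.congr' ?_
  filter_upwards [self_mem_nhdsWithin] with t ht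
  have ht' : t - c ≠ 0 := sub_ne_zero.2 ht
  simp only [slope_def_field, hfc, hsc, sub_zero]
  by_cases h : Real.sin (s t) = 0
  · simp [h]
  · field_simp

lemma wirt (f f' s σ : ℝ → ℝ) (a b : ℝ) (hab : a < b)
    (hf : ∀ t, HasDerivAt f (f' t) t) (hs : ∀ t, HasDerivAt s (σ t) t)
    (hf' : Continuous f') (hσ : Continuous σ) (hpos : ∀ t, 0 < σ t)
    (hfa : f a = 0) (hfb : f b = 0) (hsa : Real.sin (s a) = 0) (hsb : Real.sin (s b) = 0)
    (hsin : ∀ t ∈ Set.Ioo a b, Real.sin (s t) ≠ 0) :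
    0 ≤ ∫ t in a..b, (f' t ^ 2 / σ t - f t ^ 2 * σ t) := by
  have hfc : Continuous f := continuous_iff_continuousAt.2 fun t => (hf t).continuousAt
  set g : ℝ → ℝ := fun t => f' t ^ 2 / σ t - f t ^ 2 * σ t with hg
  have hgc : Continuous g := ((hf'.pow 2).div hσ fun t => (hpos t).ne').sub ((hfc.pow 2).mul hσ)
  set C : ℝ → ℝ := fun t => f t ^ 2 * (Real.cos (s t) / Real.sin (s t)) with hC
  set G : ℝ → ℝ := fun t => (∫ u in a..t, g u) - C t with hG
  have hint : ∀ t, HasDerivAt (fun t => ∫ u in a..t, g u) (g t) t := fun t =>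
    intervalIntegral.integral_hasDerivAt_right (hgc.intervalIntegrable _ _)
      (hgc.stronglyMeasurableAtFilter _ _) hgc.continuousAt
  have hCd : ∀ t ∈ Set.Ioo a b, HasDerivAt C
      (2 * f t * f' t * (Real.cos (s t) / Real.sin (s t)) - f t ^ 2 * (σ t / Real.sin (s t) ^ 2)) t := by
    intro t ht
    have h := ((hf t).pow 2).mul ((hs t).cos.div (hs t).sin (hsin t ht))
    refine HasDerivAt.congr_deriv h ?_
    have := hsin t ht
    have h2 := Real.sin_sq_add_cos_sq (s t)
    try simp only [Pi.pow_apply, Pi.div_apply]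
    field_simp
    push_cast
    have h3 : Real.cos (s t) ^ 2 = 1 - Real.sin (s t) ^ 2 := by linarith
    ring_nf
    rw [h3]
    ring
  have hmono : MonotoneOn G (Set.Icc a b) := by
    apply monotoneOn_of_deriv_nonneg (convex_Icc a b)
    · intro t ht
      apply ContinuousAt.continuousWithinAt
      apply (hint t).continuousAt.sub
      rcases eq_or_lt_of_le ht.1 with h | h
      · subst h
        exact cot_endpoint f s _ _ _ (hf _) (hs _) (hpos _) hfa hsa
      · rcases eq_or_lt_of_le ht.2 with h' | h'
        · subst h'
          exact cot_endpoint f s _ _ _ (hf _) (hs _) (hpos _) hfb hsb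
        · exact (hCd t ⟨h, h'⟩).continuousAt
    · intro t ht
      rw [interior_Icc] at ht
      exact ((hint t).sub (hCd t ht)).differentiableAt.differentiableWithinAt
    · intro t ht
      rw [interior_Icc] at ht
      have hd := ((hint t).sub (hCd t ht)).deriv
      have : deriv G t = g t - (2 * f t * f' t * (Real.cos (s t) / Real.sin (s t)) - f t ^ 2 * (σ t / Real.sin (s t) ^ 2)) := hd
      rw [this]
      have h1 := hsin t ht
      have h2 := Real.sin_sq_add_cos_sq (s t)
      have h3 := hpos t
      have : g t - (2 * f t * f' t * (Real.cos (s t) / Real.sin (s t)) - f t ^ 2 * (σ t / Real.sin (s t) ^ 2))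
        = (f' t - f t * σ t * (Real.cos (s t) / Real.sin (s t))) ^ 2 / σ t := by
        simp only [hg]
        have h4 : Real.cos (s t) ^ 2 = 1 - Real.sin (s t) ^ 2 := by linarith
        field_simp
        ring_nf
        rw [h4]
        ring
      rw [this]
      positivity
  have := hmono (Set.left_mem_Icc.2 hab.le) (Set.right_mem_Icc.2 hab.le) hab.le
  simpa [hG, hC, hfa, hfb] using this

lemma isop_eps (p q p' q' : ℝ → ℝ) (a b : ℝ) (hab : a < b)
    (hp : ∀ t, HasDerivAt p (p' t) t) (hq : ∀ t, HasDerivAt q (q' t) t)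
    (hp' : Continuous p') (hq' : Continuous q') (hpab : p a = p b) (hqab : q a = q b)
    (ε : ℝ) (hε : 0 < ε) :
    4 * π * |∫ t in a..b, p t * q' t| ≤
      (∫ t in a..b, (√(p' t ^ 2 + q' t ^ 2) + ε)) ^ 2 := by
  set w : ℝ → ℝ := fun t => √(p' t ^ 2 + q' t ^ 2) + ε with hw
  have hwc : Continuous w := by fun_prop
  have hwpos : ∀ t, 0 < w t := fun t => by positivity
  set L := ∫ t in a..b, w t with hL
  have hLpos : 0 < L := intervalIntegral.intervalIntegral_pos_of_pos (hwc.intervalIntegrable _ _) hwpos hab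
  set σ : ℝ → ℝ := fun t => (2 * π / L) * w t with hσ
  have hKpos : 0 < 2 * π / L := by positivity
  have hσc : Continuous σ := by fun_prop
  have hσpos : ∀ t, 0 < σ t := fun t => mul_pos hKpos (hwpos t)
  set s : ℝ → ℝ := fun t => ∫ u in a..t, σ u with hs
  have hsd : ∀ t, HasDerivAt s (σ t) t := fun t =>
    intervalIntegral.integral_hasDerivAt_right (hσc.intervalIntegrable _ _)
      (hσc.stronglyMeasurableAtFilter _ _) hσc.continuousAt
  have hsc : Continuous s := continuous_iff_continuousAt.2 fun t => (hsd t).continuousAt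
  have hsa : s a = 0 := by simp [hs]
  have hsb : s b = 2 * π := by
    simp only [hs, hσ]
    rw [intervalIntegral.integral_const_mul, ← hL]
    field_simp
  have hsm : StrictMono s := strictMono_of_deriv_pos fun t => by rw [(hsd t).deriv]; exact hσpos t
  obtain ⟨m, hm, hsmid⟩ : π ∈ s '' Set.Icc a b := by
    apply intermediate_value_Icc hab.le hsc.continuousOn
    rw [hsa, hsb]; constructor <;> linarith [Real.pi_pos]
  have ham : a < m := by rw [← hsm.lt_iff_lt, hsa, hsmid]; exact Real.pi_pos
  have hmb : m < b := by rw [← hsm.lt_iff_lt, hsb, hsmid]; linarith [Real.pi_pos]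
  -- unit chord direction
  obtain ⟨c, d, hcd, hch⟩ : ∃ c d : ℝ, c ^ 2 + d ^ 2 = 1 ∧ d * (p m - p a) - c * (q m - q a) = 0 := by
    set X := p m - p a
    set Y := q m - q a
    by_cases h : X ^ 2 + Y ^ 2 = 0
    · refine ⟨1, 0, by norm_num, ?_⟩
      have : Y = 0 := by nlinarith
      simp [this]
    · have h' : 0 < X ^ 2 + Y ^ 2 := lt_of_le_of_ne (by positivity) (Ne.symm h)
      have h2 := Real.sq_sqrt h'.le
      have h3 : 0 < √(X ^ 2 + Y ^ 2) := Real.sqrt_pos.2 h'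
      refine ⟨X / √(X ^ 2 + Y ^ 2), Y / √(X ^ 2 + Y ^ 2), ?_, ?_⟩
      · rw [div_pow, div_pow, h2]; field_simp
      · ring
  set x : ℝ → ℝ := fun t => d * (p t - p a) - c * (q t - q a) with hx
  set x' : ℝ → ℝ := fun t => d * p' t - c * q' t with hx'
  set y' : ℝ → ℝ := fun t => c * p' t + d * q' t with hy'
  have hxd : ∀ t, HasDerivAt x (x' t) t := fun t =>
    (((hp t).sub_const _).const_mul d).sub (((hq t).sub_const _).const_mul c)
  have hx'c : Continuous x' := by fun_prop
  have hy'c : Continuous y' := by fun_prop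
  have hpc : Continuous p := continuous_iff_continuousAt.2 fun t => (hp t).continuousAt
  have hqc : Continuous q := continuous_iff_continuousAt.2 fun t => (hq t).continuousAt
  have hxc : Continuous x := by fun_prop
  have hxa : x a = 0 := by simp [hx]
  have hxm : x m = 0 := hch
  have hxb : x b = 0 := by simp [hx, hpab, hqab]
  have W1 := wirt x x' s σ a m ham hxd hsd hx'c hσc hσpos hxa hxm (by simp [hsa]) (by simp [hsmid])
    (fun t ht => by
      apply (Real.sin_pos_of_pos_of_lt_pi _ _).ne'
      · rw [← hsa]; exact hsm ht.1
      · rw [← hsmid]; exact hsm ht.2)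
  have W2 := wirt x x' s σ m b hmb hxd hsd hx'c hσc hσpos hxm hxb (by simp [hsmid]) (by simp [hsb])
    (fun t ht => by
      have h1 : 0 < Real.sin (s t - π) := by
        apply Real.sin_pos_of_pos_of_lt_pi
        · have := hsm ht.1; rw [hsmid] at this; linarith
        · have := hsm ht.2; rw [hsb] at this; linarith
      rw [Real.sin_sub_pi] at h1
      linarith)
  have hgc : Continuous fun t => x' t ^ 2 / σ t - x t ^ 2 * σ t :=
    ((hx'c.pow 2).div hσc fun t => (hσpos t).ne').sub ((hxc.pow 2).mul hσc)
  have W : 0 ≤ ∫ t in a..b, (x' t ^ 2 / σ t - x t ^ 2 * σ t) := by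
    rw [← intervalIntegral.integral_add_adjacent_intervals (hgc.intervalIntegrable a m)
      (hgc.intervalIntegrable m b)]
    linarith
  -- area identity
  have area : ∫ t in a..b, x t * y' t = ∫ t in a..b, p t * q' t := by
    have hprim : ∫ t in a..b, (x t * y' t - p t * q' t) = 0 := by
      have := intervalIntegral.integral_eq_sub_of_hasDerivAt (a := a) (b := b)
        (f := fun t => c * d * (p t - p a) ^ 2 / 2 - c * d * (q t - q a) ^ 2 / 2
          - c ^ 2 * ((p t - p a) * (q t - q a)) - p a * q t) (f' := fun t => x t * y' t - p t * q' t)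
        (fun t _ => by
          have hP := (hp t).sub_const (p a)
          have hQ := (hq t).sub_const (q a)
          have h := ((((hP.pow 2).const_mul (c * d)).div_const 2).sub
            (((hQ.pow 2).const_mul (c * d)).div_const 2)).sub ((hP.mul hQ).const_mul (c ^ 2)) |>.sub
            ((hq t).const_mul (p a))
          refine HasDerivAt.congr_deriv h ?_
          simp only [hx, hy']
          have hd2 : d ^ 2 = 1 - c ^ 2 := by linarith
          push_cast
          ring_nf
          rw [hd2]
          ring)
        (Continuous.intervalIntegrable (by fun_prop) _ _)
      rw [this, ← hpab, ← hqab]; ring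
    rw [intervalIntegral.integral_sub (Continuous.intervalIntegrable (by fun_prop) _ _)
      (Continuous.intervalIntegrable (by fun_prop) _ _)] at hprim
    linarith
  rw [← area]
  -- main estimate
  have hcontA : Continuous fun t => x' t ^ 2 / σ t - x t ^ 2 * σ t + 2 * |x t * y' t| :=
    hgc.add (by fun_prop)
  have hpt : ∀ t ∈ Set.Icc a b,
      x' t ^ 2 / σ t - x t ^ 2 * σ t + 2 * |x t * y' t| ≤ L / (2 * π) * w t := by
    intro t _
    have hσt := hσpos t
    have h1 : 2 * |x t * y' t| ≤ x t ^ 2 * σ t + y' t ^ 2 / σ t := by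
      rw [abs_mul, ← sq_abs (x t), ← sq_abs (y' t)]
      have : |x t| ^ 2 * σ t + |y' t| ^ 2 / σ t - 2 * (|x t| * |y' t|)
        = (|x t| * σ t - |y' t|) ^ 2 / σ t := by field_simp; ring
      have h0 : 0 ≤ (|x t| * σ t - |y' t|) ^ 2 / σ t := by positivity
      linarith
    have h2 : x' t ^ 2 + y' t ^ 2 = p' t ^ 2 + q' t ^ 2 := by
      simp only [hx', hy']
      have hd2 : d ^ 2 = 1 - c ^ 2 := by linarith
      ring_nf
      rw [hd2]; ring
    have h3 : x' t ^ 2 / σ t + y' t ^ 2 / σ t ≤ L / (2 * π) * w t := by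
      rw [← add_div, h2, div_le_iff₀ hσt]
      have : L / (2 * π) * w t * σ t = w t ^ 2 := by simp only [hσ]; field_simp
      rw [this, ← Real.sq_sqrt (show 0 ≤ p' t ^ 2 + q' t ^ 2 by positivity)]
      simp only [hw]
      have := Real.sqrt_nonneg (p' t ^ 2 + q' t ^ 2)
      gcongr
      linarith
    linarith
  have I1 := intervalIntegral.integral_mono_on (μ := volume) hab.le (hcontA.intervalIntegrable a b)
    ((hwc.const_mul (L / (2 * π))).intervalIntegrable a b) hpt
  rw [intervalIntegral.integral_const_mul, ← hL, intervalIntegral.integral_add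
    (hgc.intervalIntegrable _ _) (Continuous.intervalIntegrable (by fun_prop) a b),
    intervalIntegral.integral_const_mul] at I1
  have I2 := intervalIntegral.abs_integral_le_integral_abs (f := fun t => x t * y' t) (μ := volume) hab.le
  have I3 : 2 * |∫ t in a..b, x t * y' t| ≤ L / (2 * π) * L := by linarith
  have I4 : L / (2 * π) * L = L ^ 2 / (2 * π) := by ring
  rw [I4, le_div_iff₀ (by positivity)] at I3
  linarith

lemma isop (p q p' q' : ℝ → ℝ) (a b : ℝ) (hab : a < b)
    (hp : ∀ t, HasDerivAt p (p' t) t) (hq : ∀ t, HasDerivAt q (q' t) t)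
    (hp' : Continuous p') (hq' : Continuous q') (hpab : p a = p b) (hqab : q a = q b) :
    4 * π * |∫ t in a..b, p t * q' t| ≤ (∫ t in a..b, √(p' t ^ 2 + q' t ^ 2)) ^ 2 := by
  have h : ∀ ε > 0, 4 * π * |∫ t in a..b, p t * q' t| ≤
      ((∫ t in a..b, √(p' t ^ 2 + q' t ^ 2)) + (b - a) * ε) ^ 2 := by
    intro ε hε
    have := isop_eps p q p' q' a b hab hp hq hp' hq' hpab hqab ε hε
    rw [intervalIntegral.integral_add (Continuous.intervalIntegrable (by fun_prop) a b)
      (Continuous.intervalIntegrable (by fun_prop) a b)] at this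
    simpa using this
  have ht : Tendsto (fun ε : ℝ => ((∫ t in a..b, √(p' t ^ 2 + q' t ^ 2)) + (b - a) * ε) ^ 2)
      (𝓝[>] 0) (𝓝 ((∫ t in a..b, √(p' t ^ 2 + q' t ^ 2)) ^ 2)) := by
    have : Continuous (fun ε : ℝ => ((∫ t in a..b, √(p' t ^ 2 + q' t ^ 2)) + (b - a) * ε) ^ 2) := by
      fun_prop
    have := this.tendsto 0
    simp only [mul_zero, add_zero] at this
    exact this.mono_left nhdsWithin_le_nhds
  refine ge_of_tendsto ht ?_
  filter_upwards [self_mem_nhdsWithin] with ε hε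
  exact h ε hε

lemma slope_bound (f f' : ℝ → ℝ) (x0 C : ℝ) (hf : ∀ t, HasDerivAt f (f' t) t)
    (hC : ∀ t ∈ Set.Icc (x0 - 1) (x0 + 1), |f' t| ≤ C) (x : ℝ)
    (hx : x ∈ Set.Icc (x0 - 1) (x0 + 1)) : |f x - f x0| ≤ C * |x - x0| := by
  have := (convex_Icc (x0 - 1) (x0 + 1)).norm_image_sub_le_of_norm_hasDerivWithin_le
    (f := f) (f' := f') (C := C) (fun t _ => (hf t).hasDerivWithinAt) (fun t ht => hC t ht)
    (show x0 ∈ Set.Icc (x0 - 1) (x0 + 1) by constructor <;> linarith) hx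
  simpa using this

lemma area_deriv (P Q Pr Pt Qr Qt : ℝ → ℝ → ℝ) (a b : ℝ) (hab : a ≤ b)
    (hPr : ∀ ρ t, HasDerivAt (fun ρ => P ρ t) (Pr ρ t) ρ)
    (hQr : ∀ ρ t, HasDerivAt (fun ρ => Q ρ t) (Qr ρ t) ρ)
    (hPt : ∀ ρ t, HasDerivAt (fun t => P ρ t) (Pt ρ t) t)
    (hQt : ∀ ρ t, HasDerivAt (fun t => Q ρ t) (Qt ρ t) t)
    (cPr : Continuous (Function.uncurry Pr)) (cQr : Continuous (Function.uncurry Qr))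
    (cPt : Continuous (Function.uncurry Pt)) (cQt : Continuous (Function.uncurry Qt))
    (hP : ∀ ρ, P ρ a = P ρ b) (hQ : ∀ ρ, Q ρ a = Q ρ b) (ρ0 : ℝ) :
    HasDerivAt (fun ρ => ∫ t in a..b, P ρ t * Qt ρ t)
      (∫ t in a..b, (Pr ρ0 t * Qt ρ0 t - Pt ρ0 t * Qr ρ0 t)) ρ0 := by
  have cP : ∀ ρ, Continuous (P ρ) := fun ρ =>
    continuous_iff_continuousAt.2 fun t => (hPt ρ t).continuousAt
  have cQ : ∀ ρ, Continuous (Q ρ) := fun ρ =>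
    continuous_iff_continuousAt.2 fun t => (hQt ρ t).continuousAt
  have sec : ∀ (F : ℝ → ℝ → ℝ), Continuous (Function.uncurry F) → ∀ ρ, Continuous (F ρ) :=
    fun F hF ρ => hF.comp (by fun_prop : Continuous fun t : ℝ => (ρ, t))
  have cPt1 := sec Pt cPt
  have cQt1 := sec Qt cQt
  have bd : ∀ (F : ℝ → ℝ → ℝ), Continuous (Function.uncurry F) → ∃ C : ℝ, 0 ≤ C ∧
      ∀ ρ ∈ Set.Icc (ρ0 - 1) (ρ0 + 1), ∀ t ∈ Set.Icc a b, |F ρ t| ≤ C := by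
    intro F hF
    obtain ⟨C, hC⟩ := ((isCompact_Icc (a := ρ0 - 1) (b := ρ0 + 1)).prod
      (isCompact_Icc (a := a) (b := b))).exists_bound_of_continuousOn hF.continuousOn
    exact ⟨|C|, abs_nonneg _, fun ρ hρ t ht => (hC (ρ, t) ⟨hρ, ht⟩).trans (le_abs_self _)⟩
  obtain ⟨C1, h1, hC1⟩ := bd Pr cPr
  obtain ⟨C2, h2, hC2⟩ := bd Qr cQr
  obtain ⟨C3, h3, hC3⟩ := bd Pt cPt
  obtain ⟨C4, h4, hC4⟩ := bd Qt cQt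
  rw [hasDerivAt_iff_tendsto_slope]
  have key : ∀ ρ, slope (fun ρ => ∫ t in a..b, P ρ t * Qt ρ t) ρ0 ρ =
      ∫ t in a..b, (slope (fun ρ => P ρ t) ρ0 ρ * Qt ρ t - Pt ρ0 t * slope (fun ρ => Q ρ t) ρ0 ρ) := by
    intro ρ
    have hparts : ∫ t in a..b, (Pt ρ0 t * (Q ρ t - Q ρ0 t) + P ρ0 t * (Qt ρ t - Qt ρ0 t)) = 0 := by
      rw [intervalIntegral.integral_eq_sub_of_hasDerivAt
        (f := fun t => P ρ0 t * (Q ρ t - Q ρ0 t))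
        (fun t _ => (hPt ρ0 t).mul ((hQt ρ t).sub (hQt ρ0 t)))
        (Continuous.intervalIntegrable (((cPt1 ρ0).mul ((cQ ρ).sub (cQ ρ0))).add
          ((cP ρ0).mul ((cQt1 ρ).sub (cQt1 ρ0)))) _ _)]
      rw [← hP, ← hQ, ← hQ]; ring
    have hdiff : (∫ t in a..b, P ρ t * Qt ρ t) - (∫ t in a..b, P ρ0 t * Qt ρ0 t) =
        ∫ t in a..b, ((P ρ t - P ρ0 t) * Qt ρ t - Pt ρ0 t * (Q ρ t - Q ρ0 t)) := by
      rw [← intervalIntegral.integral_sub (f := fun t => P ρ t * Qt ρ t)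
        (g := fun t => P ρ0 t * Qt ρ0 t) (((cP ρ).mul (cQt1 ρ)).intervalIntegrable _ _)
        (((cP ρ0).mul (cQt1 ρ0)).intervalIntegrable _ _)]
      rw [← sub_zero (∫ t in a..b, (P ρ t * Qt ρ t - P ρ0 t * Qt ρ0 t)), ← hparts,
        ← intervalIntegral.integral_sub]
      · congr 1; ext t; ring
      · exact (((cP ρ).mul (cQt1 ρ)).sub ((cP ρ0).mul (cQt1 ρ0))).intervalIntegrable _ _
      · exact (((cPt1 ρ0).mul ((cQ ρ).sub (cQ ρ0))).add
          ((cP ρ0).mul ((cQt1 ρ).sub (cQt1 ρ0)))).intervalIntegrable _ _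
    rw [slope_def_field, hdiff, div_eq_mul_inv, ← intervalIntegral.integral_mul_const]
    congr 1; ext t
    simp only [slope_def_field]
    ring
  refine Tendsto.congr (fun ρ => (key ρ).symm) ?_
  apply intervalIntegral.tendsto_integral_filter_of_dominated_convergence
    (fun _ => C1 * C4 + C3 * C2)
  · filter_upwards with ρ
    apply Continuous.aestronglyMeasurable
    simp only [slope_def_field]
    exact ((((cP ρ).sub (cP ρ0)).div_const _).mul (cQt1 ρ)).sub
      ((cPt1 ρ0).mul (((cQ ρ).sub (cQ ρ0)).div_const _))
  · have hn : ∀ᶠ ρ in 𝓝[≠] ρ0, ρ ∈ Set.Icc (ρ0 - 1) (ρ0 + 1) :=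
      nhdsWithin_le_nhds (Icc_mem_nhds (by linarith) (by linarith))
    filter_upwards [hn, self_mem_nhdsWithin] with ρ hρ hne
    filter_upwards with t ht
    rw [Set.uIoc_of_le hab] at ht
    have ht' : t ∈ Set.Icc a b := ⟨ht.1.le, ht.2⟩
    have hpos : 0 < |ρ - ρ0| := abs_pos.2 (sub_ne_zero.2 hne)
    have s1 : |slope (fun ρ => P ρ t) ρ0 ρ| ≤ C1 := by
      rw [slope_def_field, abs_div, div_le_iff₀ hpos]
      exact slope_bound (fun ρ => P ρ t) (fun ρ => Pr ρ t) ρ0 C1 (fun ρ => hPr ρ t)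
        (fun u hu => hC1 u hu t ht') ρ hρ
    have s2 : |slope (fun ρ => Q ρ t) ρ0 ρ| ≤ C2 := by
      rw [slope_def_field, abs_div, div_le_iff₀ hpos]
      exact slope_bound (fun ρ => Q ρ t) (fun ρ => Qr ρ t) ρ0 C2 (fun ρ => hQr ρ t)
        (fun u hu => hC2 u hu t ht') ρ hρ
    have s3 := hC4 ρ hρ t ht'
    have s4 := hC3 ρ0 ⟨by linarith, by linarith⟩ t ht'
    rw [Real.norm_eq_abs]
    refine (abs_sub _ _).trans ?_
    rw [abs_mul, abs_mul]
    gcongr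
  · exact intervalIntegrable_const
  · filter_upwards with t _
    have t1 := hasDerivAt_iff_tendsto_slope.1 (hPr ρ0 t)
    have t2 := hasDerivAt_iff_tendsto_slope.1 (hQr ρ0 t)
    have t3 : Tendsto (fun ρ => Qt ρ t) (𝓝[≠] ρ0) (𝓝 (Qt ρ0 t)) := by
      have : Continuous fun ρ => Qt ρ t := cQt.comp (by fun_prop : Continuous fun ρ : ℝ => (ρ, t))
      exact (this.tendsto ρ0).mono_left nhdsWithin_le_nhds
    exact (t1.mul t3).sub (t2.const_mul _)

lemma area_formula (P Q Pr Pt Qr Qt : ℝ → ℝ → ℝ) (a b : ℝ) (hab : a ≤ b)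
    (hPr : ∀ ρ t, HasDerivAt (fun ρ => P ρ t) (Pr ρ t) ρ)
    (hQr : ∀ ρ t, HasDerivAt (fun ρ => Q ρ t) (Qr ρ t) ρ)
    (hPt : ∀ ρ t, HasDerivAt (fun t => P ρ t) (Pt ρ t) t)
    (hQt : ∀ ρ t, HasDerivAt (fun t => Q ρ t) (Qt ρ t) t)
    (cPr : Continuous (Function.uncurry Pr)) (cQr : Continuous (Function.uncurry Qr))
    (cPt : Continuous (Function.uncurry Pt)) (cQt : Continuous (Function.uncurry Qt))
    (hP : ∀ ρ, P ρ a = P ρ b) (hQ : ∀ ρ, Q ρ a = Q ρ b) (h0 : ∀ t, Qt 0 t = 0) (r : ℝ) :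
    ∫ ρ in (0 : ℝ)..r, ∫ t in a..b, (Pr ρ t * Qt ρ t - Pt ρ t * Qr ρ t) =
      ∫ t in a..b, P r t * Qt r t := by
  rw [intervalIntegral.integral_eq_sub_of_hasDerivAt
    (fun ρ _ => area_deriv P Q Pr Pt Qr Qt a b hab hPr hQr hPt hQt cPr cQr cPt cQt hP hQ ρ)]
  · simp [h0]
  · apply Continuous.intervalIntegrable
    apply intervalIntegral.continuous_parametric_intervalIntegral_of_continuous'
    exact (cPr.mul cQt).sub (cPt.mul cQr)

lemma polar_ball (f : E2 → ℝ) (hf : Continuous f) {r : ℝ} (hr : 0 ≤ r) :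
    ∫ x in ball (0 : E2) r, f x = ∫ ρ in (0 : ℝ)..r, ∫ t in (-π)..π, ρ * f (cphi ρ t) := by
  have hψ : MeasurePreserving (fun p : ℝ × ℝ => (!₂[p.1, p.2] : E2)) volume volume :=
    (PiLp.volume_preserving_toLp (Fin 2)).comp (volume_preserving_finTwoArrow ℝ).symm
  have hemb : MeasurableEmbedding (fun p : ℝ × ℝ => (!₂[p.1, p.2] : E2)) :=
    (MeasurableEquiv.toLp 2 (Fin 2 → ℝ)).measurableEmbedding.comp
      (MeasurableEquiv.finTwoArrow (α := ℝ)).symm.measurableEmbedding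
  have hcc : Continuous fun p : ℝ × ℝ => cphi p.1 p.2 := by
    unfold cphi
    fun_prop
  have hcont : Continuous fun p : ℝ × ℝ => p.1 * f (cphi p.1 p.2) :=
    continuous_fst.mul (hf.comp hcc)
  rw [← integral_indicator measurableSet_ball, ← hψ.integral_comp hemb,
    ← integral_comp_polarCoord_symm]
  have h1 : ∀ p ∈ polarCoord.target, p.1 • (ball (0 : E2) r).indicator f
      (!₂[(polarCoord.symm p).1, (polarCoord.symm p).2] : E2) =
      (Set.Ioo 0 r ×ˢ Set.Ioo (-π) π).indicator (fun p : ℝ × ℝ => p.1 * f (cphi p.1 p.2)) p := by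
    rintro ⟨ρ, t⟩ hp
    simp only [polarCoord_target, Set.mem_prod, Set.mem_Ioi] at hp
    have hq : (!₂[(polarCoord.symm (ρ, t)).1, (polarCoord.symm (ρ, t)).2] : E2) = cphi ρ t := by
      simp [cphi, polarCoord_symm_apply]
    have hn := cphi_mem_sphere hp.1.le t
    rw [mem_sphere_zero_iff_norm] at hn
    rw [hq]
    by_cases h : ρ < r
    · rw [Set.indicator_of_mem, Set.indicator_of_mem]
      · rfl
      · exact ⟨⟨hp.1, h⟩, hp.2⟩
      · rw [mem_ball_zero_iff, hn]; exact h
    · rw [Set.indicator_of_notMem, Set.indicator_of_notMem]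
      · simp
      · exact fun h' => h h'.1.2
      · rw [mem_ball_zero_iff, hn]; exact h
  rw [setIntegral_congr_fun polarCoord.open_target.measurableSet h1,
    setIntegral_indicator (measurableSet_Ioo.prod measurableSet_Ioo)]
  have h2 : polarCoord.target ∩ (Set.Ioo 0 r ×ˢ Set.Ioo (-π) π) = Set.Ioo 0 r ×ˢ Set.Ioo (-π) π := by
    apply Set.inter_eq_right.2
    rintro ⟨ρ, t⟩ hp
    exact ⟨hp.1.1, hp.2⟩
  rw [h2, Measure.volume_eq_prod, setIntegral_prod]
  · rw [intervalIntegral.integral_of_le hr, integral_Ioc_eq_integral_Ioo]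
    congr 1; ext ρ
    rw [intervalIntegral.integral_of_le (by linarith [Real.pi_pos]), integral_Ioc_eq_integral_Ioo]
  · rw [← Measure.volume_eq_prod]
    apply (hcont.continuousOn.integrableOn_compact
      ((isCompact_Icc (a := 0) (b := r)).prod (isCompact_Icc (a := -π) (b := π)))).mono_set
    exact Set.prod_mono Set.Ioo_subset_Icc_self Set.Ioo_subset_Icc_self

lemma cphi_eq (ρ t : ℝ) : cphi ρ t = (ρ * Real.cos t) • e2 0 + (ρ * Real.sin t) • e2 1 := by
  ext i
  fin_cases i <;> simp [cphi, e2]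

lemma cphi_deriv_r (F : E2 → ℝ) (hF : Differentiable ℝ F) (ρ t : ℝ) :
    HasDerivAt (fun ρ => F (cphi ρ t))
      (Real.cos t * pd 0 F (cphi ρ t) + Real.sin t * pd 1 F (cphi ρ t)) ρ := by
  have h : HasDerivAt (fun ρ => cphi ρ t) (Real.cos t • e2 0 + Real.sin t • e2 1) ρ := by
    simp only [cphi_eq]
    have := (((hasDerivAt_id ρ).mul_const (Real.cos t)).smul_const (e2 0)).add
      (((hasDerivAt_id ρ).mul_const (Real.sin t)).smul_const (e2 1))
    exact this.congr_deriv (by simp)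
  have := (hF (cphi ρ t)).hasFDerivAt.comp_hasDerivAt ρ h
  refine this.congr_deriv ?_
  simp [pd]

lemma cphi_deriv_t (F : E2 → ℝ) (hF : Differentiable ℝ F) (ρ t : ℝ) :
    HasDerivAt (fun t => F (cphi ρ t))
      (ρ * (-Real.sin t * pd 0 F (cphi ρ t) + Real.cos t * pd 1 F (cphi ρ t))) t := by
  have h : HasDerivAt (fun t => cphi ρ t) ((ρ * -Real.sin t) • e2 0 + (ρ * Real.cos t) • e2 1) t := by
    simp only [cphi_eq]
    exact (((Real.hasDerivAt_cos t).const_mul ρ).smul_const (e2 0)).add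
      (((Real.hasDerivAt_sin t).const_mul ρ).smul_const (e2 1))
  have := (hF (cphi ρ t)).hasFDerivAt.comp_hasDerivAt t h
  refine this.congr_deriv ?_
  simp [pd]
  ring

lemma pd_contDiff (v : E2 → ℝ) (hv : ContDiff ℝ 2 v) (i : Fin 2) : ContDiff ℝ 1 (pd i v) :=
  (hv.fderiv_right (m := 1) (by norm_num)).clm_apply contDiff_const

lemma pd_cont (F : E2 → ℝ) (hF : ContDiff ℝ 1 F) (i : Fin 2) : Continuous (pd i F) :=
  (hF.continuous_fderiv (by norm_num)).clm_apply continuous_const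

/-- Sobolev/isoperimetric inequality for the Hessian determinant. -/
theorem stmt_4 (v : E2 → ℝ) (hv : ContDiff ℝ 2 v) (r : ℝ) (hr : r ∈ Set.Icc (0 : ℝ) 1) :
    Real.sqrt (4 * π * |∫ x in ball (0 : E2) r, (hess v x).det|) ≤
      ∫ x in sphere (0 : E2) r, Real.sqrt (frob2 (hess v x)) ∂μH[1] := by
  rcases eq_or_lt_of_le hr.1 with h0 | hpos
  · subst h0
    simp only [ball_zero, Measure.restrict_empty, integral_zero_measure, abs_zero, mul_zero,
      Real.sqrt_zero]
    exact integral_nonneg fun x => Real.sqrt_nonneg _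
  have hF : ∀ j, ContDiff ℝ 1 (pd j v) := pd_contDiff v hv
  have hD : ∀ j, Differentiable ℝ (pd j v) := fun j => (hF j).differentiable (by norm_num)
  have hc : ∀ i j, Continuous (pd i (pd j v)) := fun i j => pd_cont _ (hF j) i
  have c00 := hc 0 0
  have c01 := hc 0 1
  have c10 := hc 1 0
  have c11 := hc 1 1
  have hcc : Continuous fun p : ℝ × ℝ => cphi p.1 p.2 := by
    unfold cphi
    fun_prop
  have hcc1 : ∀ ρ, Continuous fun t : ℝ => cphi ρ t := fun ρ => by
    unfold cphi
    fun_prop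
  have hdet : ∀ x, (hess v x).det = pd 0 (pd 0 v) x * pd 1 (pd 1 v) x - pd 0 (pd 1 v) x * pd 1 (pd 0 v) x := by
    intro x
    rw [Matrix.det_fin_two]
    simp [hess]
  have hfrob : ∀ x, frob2 (hess v x) = pd 0 (pd 0 v) x ^ 2 + pd 0 (pd 1 v) x ^ 2 +
      (pd 1 (pd 0 v) x ^ 2 + pd 1 (pd 1 v) x ^ 2) := by
    intro x
    simp [frob2, hess, Fin.sum_univ_two]
  have cdet : Continuous fun x => (hess v x).det := by
    simp only [hdet]; fun_prop
  have cfrob : Continuous fun x => √(frob2 (hess v x)) := by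
    simp only [hfrob]; fun_prop
  rw [polar_ball _ cdet hpos.le, sphere_integral hpos _ cfrob]
  have hpp : -π < π := by linarith [Real.pi_pos]
  have hper : ∀ ρ, cphi ρ (-π) = cphi ρ π := fun ρ => by simp [cphi]
  have area := area_formula (fun ρ t => pd 0 v (cphi ρ t)) (fun ρ t => pd 1 v (cphi ρ t))
    _ _ _ _ (-π) π hpp.le
    (fun ρ t => cphi_deriv_r _ (hD 0) ρ t) (fun ρ t => cphi_deriv_r _ (hD 1) ρ t)
    (fun ρ t => cphi_deriv_t _ (hD 0) ρ t) (fun ρ t => cphi_deriv_t _ (hD 1) ρ t)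
    (by simp only [Function.uncurry_def]; fun_prop) (by simp only [Function.uncurry_def]; fun_prop)
    (by simp only [Function.uncurry_def]; fun_prop) (by simp only [Function.uncurry_def]; fun_prop)
    (fun ρ => by rw [hper]) (fun ρ => by rw [hper]) (fun t => by simp) r
  have hJ : ∫ ρ in (0 : ℝ)..r, ∫ t in (-π)..π, ρ * (hess v (cphi ρ t)).det =
      ∫ t in (-π)..π, pd 0 v (cphi r t) *
        (r * (-Real.sin t * pd 0 (pd 1 v) (cphi r t) + Real.cos t * pd 1 (pd 1 v) (cphi r t))) := by
    rw [← area]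
    congr 1; ext ρ
    congr 1; ext t
    rw [hdet]
    have h3 : Real.cos t ^ 2 = 1 - Real.sin t ^ 2 := by linarith [Real.sin_sq_add_cos_sq t]
    ring_nf
    rw [h3]
    ring
  rw [hJ]
  have iso := isop (fun t => pd 0 v (cphi r t)) (fun t => pd 1 v (cphi r t)) _ _ (-π) π hpp
    (fun t => cphi_deriv_t _ (hD 0) r t) (fun t => cphi_deriv_t _ (hD 1) r t)
    (by have := hcc1 r; fun_prop) (by have := hcc1 r; fun_prop) (by simp only [hper]) (by simp only [hper])
  refine (Real.sqrt_le_sqrt iso).trans ?_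
  rw [Real.sqrt_sq (intervalIntegral.integral_nonneg hpp.le fun t _ => Real.sqrt_nonneg _)]
  have hcr := hcc1 r
  apply intervalIntegral.integral_mono_on hpp.le
  · apply Continuous.intervalIntegrable; fun_prop
  · exact (continuous_const.mul (cfrob.comp hcr)).intervalIntegrable _ _
  intro t _
  rw [← Real.sqrt_sq hpos.le, ← Real.sqrt_mul (sq_nonneg _), Real.sqrt_sq hpos.le]
  apply Real.sqrt_le_sqrt
  rw [hfrob, mul_pow, mul_pow, ← mul_add]
  apply mul_le_mul_of_nonneg_left _ (sq_nonneg _)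
  have cs : ∀ A B : ℝ, (-Real.sin t * A + Real.cos t * B) ^ 2 ≤ A ^ 2 + B ^ 2 := by
    intro A B
    have : A ^ 2 + B ^ 2 - (-Real.sin t * A + Real.cos t * B) ^ 2 =
        (Real.cos t * A + Real.sin t * B) ^ 2 := by
      have h3 : Real.cos t ^ 2 = 1 - Real.sin t ^ 2 := by linarith [Real.sin_sq_add_cos_sq t]
      ring_nf
      rw [h3]; ring
    nlinarith [sq_nonneg (Real.cos t * A + Real.sin t * B)]
  have a1 := cs (pd 0 (pd 0 v) (cphi r t)) (pd 1 (pd 0 v) (cphi r t))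
  have a2 := cs (pd 0 (pd 1 v) (cphi r t)) (pd 1 (pd 1 v) (cphi r t))
  linarith
end
end

section
/- Let 0<Δ<1 and let y^Δ: B₁→ℝ³ be the cone map y^Δ(x) = √(1−Δ²)·(x,0) + Δ|x| e₃. Then for every Φ ∈ C²_c(B₁; ℝ), ∫_{B₁} [ (y^Δ_{,1}·y^Δ_{,2}) Φ_{,12} − (1/2)|y^Δ_{,1}|² Φ_{,22} − (1/2)|y^Δ_{,2}|² Φ_{,11} ] dL² = πΔ² Φ(0). In other words, the distributional Hessian determinant sum Σ_i det D²y^Δ_i equals πΔ² δ₀. -/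
open MeasureTheory Metric Real Filter Matrix
open scoped ENNReal Topology

noncomputable section

def nv (θ : ℝ) : E2 := Real.cos θ • e2 0 + Real.sin θ • e2 1
def tv (θ : ℝ) : E2 := -Real.sin θ • e2 0 + Real.cos θ • e2 1
def tx (x : E2) : E2 := -(x 1) • e2 0 + (x 0) • e2 1

theorem nv_deriv (θ : ℝ) : HasDerivAt nv (tv θ) θ := by
  unfold nv tv
  exact ((Real.hasDerivAt_cos θ).smul_const _).add ((Real.hasDerivAt_sin θ).smul_const _)

theorem tv_deriv (θ : ℝ) : HasDerivAt tv (-(nv θ)) θ := by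
  unfold tv nv
  have := ((Real.hasDerivAt_sin θ).neg.smul_const (e2 0)).add
    ((Real.hasDerivAt_cos θ).smul_const (e2 1))
  convert! this using 1
  module

theorem nv_cont : Continuous nv := by unfold nv; fun_prop
theorem tv_cont : Continuous tv := by unfold tv; fun_prop

theorem nv_norm (θ : ℝ) : ‖nv θ‖ = 1 := by
  simp [nv, e2, EuclideanSpace.norm_eq]

theorem tx_norm (x : E2) : ‖tx x‖ = ‖x‖ := by
  simp [tx, e2, EuclideanSpace.norm_eq, add_comm]

theorem tx_nv (r θ : ℝ) : tx (r • nv θ) = r • tv θ := by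
  simp [tx, nv, tv, e2, smul_smul]

theorem intOn_of_cont (f : ℝ × ℝ → ℝ) (hf : Continuous f) (h0 : ∀ p, 1 ≤ p.1 → f p = 0) :
    IntegrableOn f (Set.Ioi 0 ×ˢ Set.Ioo (-π) π) := by
  have h1 : IntegrableOn f (Set.Icc 0 1 ×ˢ Set.Icc (-π) π) :=
    hf.continuousOn.integrableOn_compact (isCompact_Icc.prod isCompact_Icc)
  refine h1.of_forall_sdiff_eq_zero (by measurability) ?_
  rintro ⟨r, θ⟩ ⟨⟨hr, hθ⟩, h⟩
  apply h0
  by_contra hlt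
  simp only [Set.mem_Ioi, Set.mem_Ioo] at hr hθ
  exact h ⟨⟨le_of_lt hr, by simpa using (le_of_lt (not_le.mp hlt))⟩, hθ.1.le, hθ.2.le⟩

theorem integral_polar (G : E2 → ℝ) :
    ∫ x, G x = ∫ p in Set.Ioi (0:ℝ) ×ˢ Set.Ioo (-π) π, p.1 * G (p.1 • nv p.2) := by
  rw [← (PiLp.volume_preserving_toLp (Fin 2)).integral_comp
    (MeasurableEquiv.toLp 2 (Fin 2 → ℝ)).measurableEmbedding,
    ← ((volume_preserving_finTwoArrow ℝ).symm _).integral_comp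
      (MeasurableEquiv.measurableEmbedding _), ← integral_comp_polarCoord_symm]
  refine setIntegral_congr_fun (by simp only [polarCoord_target]; measurability) ?_
  rintro ⟨r, θ⟩ _
  simp only [smul_eq_mul, polarCoord_symm_apply]
  congr 2
  ext i
  fin_cases i <;> simp [nv, e2]

section
variable (Φ : E2 → ℝ) (hΦ : ContDiff ℝ 2 Φ) (hsupp : HasCompactSupport Φ)
    (hsub : tsupport Φ ⊆ ball (0 : E2) 1)

theorem D_zero (hsub : tsupport Φ ⊆ ball (0 : E2) 1) (x : E2) (hx : 1 ≤ ‖x‖) :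
    Φ x = 0 ∧ fderiv ℝ Φ x = 0 ∧ fderiv ℝ (fderiv ℝ Φ) x = 0 := by
  have h0 : x ∉ tsupport Φ := fun h => by simpa [not_lt.mpr hx] using hsub h
  have h1 : x ∉ tsupport (fderiv ℝ Φ) := fun h => h0 (tsupport_fderiv_subset ℝ h)
  have h2 : x ∉ tsupport (fderiv ℝ (fderiv ℝ Φ)) := fun h => h1 (tsupport_fderiv_subset ℝ h)
  exact ⟨image_eq_zero_of_notMem_tsupport h0, image_eq_zero_of_notMem_tsupport h1,
    image_eq_zero_of_notMem_tsupport h2⟩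

theorem cD1 (hΦ : ContDiff ℝ 2 Φ) : ContDiff ℝ 1 (fderiv ℝ Φ) :=
  hΦ.fderiv_right (by norm_num)
theorem cD2 (hΦ : ContDiff ℝ 2 Φ) : Continuous (fderiv ℝ (fderiv ℝ Φ)) :=
  (cD1 Φ hΦ).continuous_fderiv (by norm_num)

def Qf (x : E2) : ℝ := fderiv ℝ (fderiv ℝ Φ) x (tx x) (tx x) / ‖x‖ ^ 2

theorem int_norm_gen {F : Type*} [NormedAddCommGroup F] (f : E2 → F)
    (hf : Continuous f) (hs : HasCompactSupport f) : Integrable (fun x => ‖f x‖) :=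
  hf.norm.integrable_of_hasCompactSupport hs.norm

theorem Q_int (hΦ : ContDiff ℝ 2 Φ) (hsupp : HasCompactSupport Φ) : Integrable (Qf Φ) := by
  have h := cD2 Φ hΦ
  have hi : Integrable (fun x => ‖fderiv ℝ (fderiv ℝ Φ) x‖) :=
    int_norm_gen (F := E2 →L[ℝ] E2 →L[ℝ] ℝ) _ h ((hsupp.fderiv ℝ).fderiv ℝ)
  have ht : Continuous tx := by unfold tx; fun_prop
  refine hi.mono' ?_ ?_
  · apply Measurable.aestronglyMeasurable
    unfold Qf
    apply Measurable.div
    · exact Continuous.measurable ((h.clm_apply ht).clm_apply ht)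
    · exact Continuous.measurable (by fun_prop)
  · refine Eventually.of_forall fun x => ?_
    unfold Qf
    rw [norm_div, norm_pow, norm_norm]
    apply div_le_of_le_mul₀ (by positivity) (by positivity)
    have := (fderiv ℝ (fderiv ℝ Φ) x).le_opNorm₂ (tx x) (tx x)
    rw [tx_norm] at this
    linarith

def Af (p : ℝ × ℝ) : ℝ := fderiv ℝ (fderiv ℝ Φ) (p.1 • nv p.2) (p.1 • tv p.2) (tv p.2)
  - fderiv ℝ Φ (p.1 • nv p.2) (nv p.2)
def Bf (p : ℝ × ℝ) : ℝ := fderiv ℝ Φ (p.1 • nv p.2) (nv p.2)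

theorem A_int (hΦ : ContDiff ℝ 2 Φ) (hsub : tsupport Φ ⊆ ball (0 : E2) 1) :
    IntegrableOn (Af Φ) (Set.Ioi 0 ×ˢ Set.Ioo (-π) π) := by
  have h1 := (cD1 Φ hΦ).continuous
  have h2 := cD2 Φ hΦ
  have h3 := nv_cont
  have h4 := tv_cont
  apply intOn_of_cont
  · unfold Af; fun_prop
  · intro p hp
    have := D_zero Φ hsub (p.1 • nv p.2) (by
      rw [norm_smul, nv_norm]; simpa using hp.trans (le_abs_self _))
    simp [Af, this.2.1, this.2.2]

theorem B_int (hΦ : ContDiff ℝ 2 Φ) (hsub : tsupport Φ ⊆ ball (0 : E2) 1) :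
    IntegrableOn (Bf Φ) (Set.Ioi 0 ×ˢ Set.Ioo (-π) π) := by
  have h1 := (cD1 Φ hΦ).continuous
  have h3 := nv_cont
  apply intOn_of_cont
  · unfold Bf; fun_prop
  · intro p hp
    have := D_zero Φ hsub (p.1 • nv p.2) (by
      rw [norm_smul, nv_norm]; simpa using hp.trans (le_abs_self _))
    simp [Bf, this.2.1]

theorem A_zero (hΦ : ContDiff ℝ 2 Φ) (hsub : tsupport Φ ⊆ ball (0 : E2) 1) :
    ∫ p in Set.Ioi (0:ℝ) ×ˢ Set.Ioo (-π) π, Af Φ p = 0 := by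
  rw [Measure.volume_eq_prod, setIntegral_prod _ (A_int Φ hΦ hsub)]
  have h1 := (cD1 Φ hΦ).continuous
  have h2 := cD2 Φ hΦ
  have h3 := nv_cont
  have h4 := tv_cont
  have : ∀ r : ℝ, ∫ θ in Set.Ioo (-π) π, Af Φ (r, θ) = 0 := by
    intro r
    rw [← integral_Ioc_eq_integral_Ioo,
      ← intervalIntegral.integral_of_le (by linarith [pi_pos]),
      intervalIntegral.integral_eq_sub_of_hasDerivAt
        (f := fun θ => fderiv ℝ Φ (r • nv θ) (tv θ))]
    · simp [nv, tv]
    · intro θ _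
      have hd := ((cD1 Φ hΦ).differentiable (by norm_num) (r • nv θ)).hasFDerivAt.comp_hasDerivAt θ
        ((nv_deriv θ).const_smul r)
      have := hd.clm_apply (tv_deriv θ)
      convert! this using 1
      simp [Af, sub_eq_add_neg]
    · apply Continuous.intervalIntegrable
      unfold Af; fun_prop
  simp [this]

theorem B_val (hΦ : ContDiff ℝ 2 Φ) (hsub : tsupport Φ ⊆ ball (0 : E2) 1) :
    ∫ p in Set.Ioi (0:ℝ) ×ˢ Set.Ioo (-π) π, Bf Φ p = - (2 * π * Φ 0) := by
  have hI := B_int Φ hΦ hsub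
  rw [Measure.volume_eq_prod] at hI ⊢
  rw [← Measure.prod_restrict, integral_prod_symm _ (by rwa [Measure.prod_restrict])]
  have h1 := (cD1 Φ hΦ).continuous
  have : ∀ θ : ℝ, ∫ r in Set.Ioi (0:ℝ), Bf Φ (r, θ) = - Φ 0 := by
    intro θ
    have hz : ∀ r : ℝ, 1 ≤ r → 1 ≤ ‖r • nv θ‖ := fun r hr => by
      rw [norm_smul, nv_norm]; simpa using hr.trans (le_abs_self _)
    rw [integral_Ioi_of_hasDerivAt_of_tendsto' (f := fun r => Φ (r • nv θ)) (m := 0)]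
    · simp
    · intro r _
      have hd := (hΦ.differentiable (by norm_num) (r • nv θ)).hasFDerivAt.comp_hasDerivAt r
        ((hasDerivAt_id r).smul_const (nv θ))
      simpa [Bf] using! hd
    · have hc : IntegrableOn (fun r => Bf Φ (r, θ)) (Set.Icc 0 1) :=
        Continuous.integrableOn_Icc (by
          have h3 := nv_cont
          have : Continuous (Bf Φ) := by unfold Bf; fun_prop
          fun_prop)
      refine hc.of_forall_sdiff_eq_zero measurableSet_Ioi ?_
      rintro r ⟨hr, h⟩
      have : 1 ≤ r := by
        by_contra hlt
        exact h ⟨le_of_lt hr, le_of_lt (not_le.mp hlt)⟩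
      simp [Bf, (D_zero Φ hsub _ (hz r this)).2.1]
    · apply tendsto_const_nhds.congr'
      filter_upwards [eventually_ge_atTop 1] with r hr
      exact (D_zero Φ hsub _ (hz r hr)).1.symm
  simp only [this]
  simp [pi_pos.le]
  left
  ring

theorem Q_val (hΦ : ContDiff ℝ 2 Φ) (hsub : tsupport Φ ⊆ ball (0 : E2) 1) :
    ∫ x, Qf Φ x = - (2 * π * Φ 0) := by
  have hAB := integral_add (A_int Φ hΦ hsub) (B_int Φ hΦ hsub)
  rw [A_zero Φ hΦ hsub, B_val Φ hΦ hsub, zero_add] at hAB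
  rw [integral_polar, ← hAB]
  refine setIntegral_congr_fun (by measurability) ?_
  rintro ⟨r, θ⟩ ⟨hr, _⟩
  have hr : 0 < r := hr
  simp only [Qf, Af, Bf, tx_nv, norm_smul, nv_norm, map_smul, smul_eq_mul]
  simp only [_root_.smul_apply, smul_eq_mul, norm_eq_abs, mul_one, sq_abs]
  field_simp
  ring

theorem lap_int (hΦ : ContDiff ℝ 2 Φ) (hsupp : HasCompactSupport Φ) (v w : E2) :
    Integrable (fun x => fderiv ℝ (fderiv ℝ Φ) x v w) := by
  have h := cD2 Φ hΦ
  apply Continuous.integrable_of_hasCompactSupport (by fun_prop)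
  exact ((hsupp.fderiv ℝ).fderiv ℝ).mono (fun x hx h => by simp [h] at hx)

theorem D2_apply (hΦ : ContDiff ℝ 2 Φ) (x v w : E2) :
    fderiv ℝ (fun z => fderiv ℝ Φ z w) x v = fderiv ℝ (fderiv ℝ Φ) x v w := by
  have := ((cD1 Φ hΦ).differentiable (by norm_num) x).hasFDerivAt.clm_apply
    (hasFDerivAt_const w x)
  rw [this.fderiv]
  simp

theorem lap_zero (hΦ : ContDiff ℝ 2 Φ) (hsupp : HasCompactSupport Φ) (v w : E2) :
    ∫ x, fderiv ℝ (fderiv ℝ Φ) x v w = 0 := by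
  have h := integral_mul_fderiv_eq_neg_fderiv_mul_of_integrable (μ := (volume : Measure E2))
    (f := fun _ => (1:ℝ)) (g := fun z => fderiv ℝ Φ z w) (v := v)
    (by simp) (by simpa [D2_apply Φ hΦ] using lap_int Φ hΦ hsupp v w)
    (by
      simp only [one_mul]
      have h1 := (cD1 Φ hΦ).continuous
      apply Continuous.integrable_of_hasCompactSupport (by fun_prop)
      exact (hsupp.fderiv ℝ).mono (fun x hx h => by simp [h] at hx))
    (by intros; fun_prop)
    (by
      intro x _
      exact ((cD1 Φ hΦ).differentiable (by norm_num) x).clm_apply (differentiableAt_const w))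
  simpa [D2_apply Φ hΦ] using h

theorem hess_eq (hΦ : ContDiff ℝ 2 Φ) (x : E2) (i j : Fin 2) :
    hess Φ x i j = fderiv ℝ (fderiv ℝ Φ) x (e2 i) (e2 j) := by
  rw [← D2_apply Φ hΦ]; rfl

end

theorem pd_norm (x : E2) (hx : x ≠ 0) (c : ℝ) (j : Fin 2) :
    pd j (fun z => c * ‖z‖) x = c * (x j / ‖x‖) := by
  have h := ((hasStrictFDerivAt_norm_sq x).hasFDerivAt.sqrt (by simpa using hx)).const_mul c
  simp only [Real.sqrt_sq (norm_nonneg _)] at h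
  rw [pd, h.fderiv]
  simp [e2, EuclideanSpace.inner_single_right]
  left
  field_simp

theorem pd_coord (x : E2) (c : ℝ) (i j : Fin 2) :
    pd j (fun z => c * z i) x = if i = j then c else 0 := by
  have h := ((EuclideanSpace.proj (𝕜 := ℝ) i : E2 →L[ℝ] ℝ).hasFDerivAt (x := x)).const_mul c
  have h' : HasFDerivAt (fun z : E2 => c * z i) _ x := h
  rw [pd, h'.fderiv]
  simp [e2]

theorem gmet_eq (Δ : ℝ) (h : 0 ≤ 1 - Δ ^ 2) (x : E2) (hx : x ≠ 0) (i j : Fin 2) :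
    gmet (coneMap Δ) x i j = (if i = j then 1 - Δ ^ 2 else 0) + Δ ^ 2 * (x i * x j / ‖x‖ ^ 2) := by
  have hs := Real.mul_self_sqrt h
  have e : ∀ k, Dmat (coneMap Δ) x 0 k = if 0 = k then √(1 - Δ ^ 2) else 0 := fun k =>
    pd_coord x (√(1 - Δ ^ 2)) 0 k
  have e1 : ∀ k, Dmat (coneMap Δ) x 1 k = if 1 = k then √(1 - Δ ^ 2) else 0 := fun k =>
    pd_coord x (√(1 - Δ ^ 2)) 1 k
  have e3 : ∀ k, Dmat (coneMap Δ) x 2 k = Δ * (x k / ‖x‖) := fun k => pd_norm x hx Δ k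
  simp only [gmet, Matrix.mul_apply, Matrix.transpose_apply, Fin.sum_univ_three, e, e1, e3]
  have hn : ‖x‖ ≠ 0 := by simpa using hx
  fin_cases i <;> fin_cases j <;> simp [hs] <;> field_simp

/-- the distributional Hessian determinant sum of the cone is `πΔ²δ₀`. -/
theorem stmt_7 (Δ : ℝ) (hΔ0 : 0 < Δ) (hΔ1 : Δ < 1) (Φ : E2 → ℝ)
    (hΦ : ContDiff ℝ 2 Φ) (hsupp : HasCompactSupport Φ)
    (hsub : tsupport Φ ⊆ ball (0 : E2) 1) :
    ∫ x in ball (0 : E2) 1,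
        (gmet (coneMap Δ) x 0 1 * hess Φ x 0 1
          - (1 / 2) * gmet (coneMap Δ) x 0 0 * hess Φ x 1 1
          - (1 / 2) * gmet (coneMap Δ) x 1 1 * hess Φ x 0 0)
      = π * Δ ^ 2 * Φ 0 := by
  have hzero : ∀ x ∉ ball (0 : E2) 1, (gmet (coneMap Δ) x 0 1 * hess Φ x 0 1
          - (1 / 2) * gmet (coneMap Δ) x 0 0 * hess Φ x 1 1
          - (1 / 2) * gmet (coneMap Δ) x 1 1 * hess Φ x 0 0) = 0 := by
    intro x hx
    have := (D_zero Φ hsub x (by simpa using hx)).2.2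
    simp [hess_eq Φ hΦ, this]
  rw [setIntegral_eq_integral_of_forall_compl_eq_zero hzero]
  have hd : 0 ≤ 1 - Δ ^ 2 := by nlinarith
  have hae : ∀ᵐ x : E2, (gmet (coneMap Δ) x 0 1 * hess Φ x 0 1
          - (1 / 2) * gmet (coneMap Δ) x 0 0 * hess Φ x 1 1
          - (1 / 2) * gmet (coneMap Δ) x 1 1 * hess Φ x 0 0)
      = (-(1 - Δ ^ 2) / 2) * (fderiv ℝ (fderiv ℝ Φ) x (e2 0) (e2 0)
        + fderiv ℝ (fderiv ℝ Φ) x (e2 1) (e2 1)) + (-(Δ ^ 2) / 2) * Qf Φ x := by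
    filter_upwards [compl_mem_ae_iff.mpr (measure_singleton (0 : E2))] with x hx
    have hx : x ≠ 0 := hx
    have hn : ‖x‖ ≠ 0 := by simpa using hx
    have hsymm : fderiv ℝ (fderiv ℝ Φ) x (e2 1) (e2 0) = fderiv ℝ (fderiv ℝ Φ) x (e2 0) (e2 1) :=
      (hΦ.contDiffAt (x := x)).isSymmSndFDerivAt (by simp) (e2 1) (e2 0)
    simp only [gmet_eq Δ hd x hx, hess_eq Φ hΦ, Qf, tx, map_add, map_smul,
      _root_.add_apply, _root_.smul_apply, smul_eq_mul, hsymm]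
    simp
    field_simp
    ring
  have hL : Integrable (fun x => (-(1 - Δ ^ 2) / 2) * (fderiv ℝ (fderiv ℝ Φ) x (e2 0) (e2 0)
        + fderiv ℝ (fderiv ℝ Φ) x (e2 1) (e2 1))) :=
    ((lap_int Φ hΦ hsupp _ _).add (lap_int Φ hΦ hsupp _ _)).const_mul _
  rw [integral_congr_ae hae, integral_add hL
    ((Q_int Φ hΦ hsupp).const_mul _), integral_const_mul, integral_const_mul,
    integral_add (lap_int Φ hΦ hsupp _ _) (lap_int Φ hΦ hsupp _ _),
    lap_zero Φ hΦ hsupp, lap_zero Φ hΦ hsupp, Q_val Φ hΦ hsub]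
  ring
end
end
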